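/- Let X ⊆ ℝ^s be compact, f : X → ℝ^p continuous, M_0 a p×p positive definite symmetric real matrix, and a ∈ (0,1). For a Borel probability measure ξ on X let M(ξ) = ∫_X f(x) f(x)ᵀ dξ(x), R(ξ) = a·M(ξ) + (1−a)·M_0, and ν_ξ(x) = trace( M(ξ) R(ξ)⁻¹ ) − f(x)ᵀ R(ξ)⁻¹ f(x). Then a Borel probability measure ξ* maximizes det R(ξ) over all Borel probability measures on X if and only if ξ* maximizes the function ξ ↦ inf_{x ∈ X} ν_ξ(x) over all Borel probability measures on X; moreover the maximal value of ξ ↦ inf_{x ∈ X} ν_ξ(x) is 0. -/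

import Mathlib

open Matrix MeasureTheory

/-- Information matrix `M(ξ) = ∫ f(x) f(x)ᵀ dξ(x)` of a design `ξ` on `X`. -/
noncomputable def infoM {s p : ℕ} {X : Set (Fin s → ℝ)} (f : X → Fin p → ℝ)
    (ξ : Measure X) : Matrix (Fin p) (Fin p) ℝ :=
  Matrix.of fun i j => ∫ x, f x i * f x j ∂ξ

/-- Augmented information matrix `R(ξ) = a M(ξ) + (1 − a) M₀`. -/
noncomputable def augM {s p : ℕ} {X : Set (Fin s → ℝ)} (f : X → Fin p → ℝ)
    (M0 : Matrix (Fin p) (Fin p) ℝ) (a : ℝ) (ξ : Measure X) :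
    Matrix (Fin p) (Fin p) ℝ :=
  a • infoM f ξ + (1 - a) • M0

/-- Sensitivity function `ν_ξ(x) = trace(M(ξ) R(ξ)⁻¹) − f(x)ᵀ R(ξ)⁻¹ f(x)`. -/
noncomputable def sens {s p : ℕ} {X : Set (Fin s → ℝ)} (f : X → Fin p → ℝ)
    (M0 : Matrix (Fin p) (Fin p) ℝ) (a : ℝ) (ξ : Measure X) (x : X) : ℝ :=
  Matrix.trace (infoM f ξ * (augM f M0 a ξ)⁻¹) - f x ⬝ᵥ (augM f M0 a ξ)⁻¹ *ᵥ f x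

open scoped MatrixOrder in
lemma exists_factor {p : ℕ} {A : Matrix (Fin p) (Fin p) ℝ} (hA : A.PosSemidef) :
    ∃ B : Matrix (Fin p) (Fin p) ℝ, A = Bᴴ * B := by
  obtain ⟨B, hB⟩ := CStarAlgebra.nonneg_iff_eq_star_mul_self.mp hA.nonneg
  exact ⟨B, hB⟩

lemma det_le_exp_trace {p : ℕ} {A : Matrix (Fin p) (Fin p) ℝ} (hA : A.PosSemidef) :
    A.det ≤ Real.exp (A.trace - p) := by
  rw [hA.1.det_eq_prod_eigenvalues, hA.1.trace_eq_sum_eigenvalues]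
  have h1 : ∑ i, ((hA.1.eigenvalues i : ℝ)) - (p : ℝ) = ∑ i, (hA.1.eigenvalues i - 1) := by
    simp
  simp only [RCLike.ofReal_real_eq_id, id]
  rw [h1, Real.exp_sum]
  refine Finset.prod_le_prod (fun i _ => hA.eigenvalues_nonneg i) (fun i _ => ?_)
  have := Real.add_one_le_exp (hA.1.eigenvalues i - 1)
  linarith

lemma det_le_of_trace {p : ℕ} {R S : Matrix (Fin p) (Fin p) ℝ} (hR : R.PosDef)
    (hS : S.PosSemidef) (h : (S * R⁻¹).trace ≤ p) : S.det ≤ R.det := by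
  obtain ⟨B, hB⟩ := exists_factor hR.inv.posSemidef
  have h1 := det_le_exp_trace (hS.mul_mul_conjTranspose_same B)
  have h2 : (B * S * Bᴴ).trace = (S * R⁻¹).trace := by
    rw [hB, Matrix.trace_mul_cycle, Matrix.trace_mul_comm]
  have h3 : (B * S * Bᴴ).det = R⁻¹.det * S.det := by
    rw [hB]; simp only [Matrix.det_mul]; ring
  have h4 : Real.exp ((S * R⁻¹).trace - p) ≤ 1 := by
    rw [Real.exp_le_one_iff]; linarith
  have hd := hR.det_pos
  rw [h2, h3, Matrix.det_nonsing_inv, Ring.inverse_eq_inv'] at h1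
  have h5 := h1.trans h4
  rw [inv_mul_le_iff₀ hd] at h5
  linarith

section
variable {s p : ℕ} {X : Set (Fin s → ℝ)}

lemma integrable_cont [CompactSpace X] {g : X → ℝ} (hg : Continuous g)
    (ξ : Measure X) [IsFiniteMeasure ξ] : Integrable g ξ :=
  hg.integrable_of_hasCompactSupport (HasCompactSupport.of_compactSpace g)

lemma quad_expand (A : Matrix (Fin p) (Fin p) ℝ) (v : Fin p → ℝ) :
    v ⬝ᵥ A *ᵥ v = ∑ i, ∑ j, (v i * v j) * A j i := by
  simp only [dotProduct, mulVec, Finset.mul_sum]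
  rw [Finset.sum_comm]
  exact Finset.sum_congr rfl fun i _ => Finset.sum_congr rfl fun j _ => by ring

lemma trace_infoM [CompactSpace X] {f : X → Fin p → ℝ} (hf : Continuous f)
    (ξ : Measure X) [IsFiniteMeasure ξ] (A : Matrix (Fin p) (Fin p) ℝ) :
    (infoM f ξ * A).trace = ∫ x, f x ⬝ᵥ A *ᵥ f x ∂ξ := by
  have hc : ∀ i, Continuous fun x => f x i := fun i => (continuous_apply i).comp hf
  simp only [quad_expand]
  rw [integral_finsetSum _ fun i _ => integrable_cont (by fun_prop) ξ]
  simp only [Matrix.trace, Matrix.diag, Matrix.mul_apply, infoM, Matrix.of_apply]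
  refine Finset.sum_congr rfl fun i _ => ?_
  rw [integral_finsetSum _ fun j _ => integrable_cont (by fun_prop) ξ]
  refine Finset.sum_congr rfl fun j _ => ?_
  rw [integral_mul_const]

lemma infoM_posSemidef [CompactSpace X] {f : X → Fin p → ℝ} (hf : Continuous f)
    (ξ : Measure X) [IsFiniteMeasure ξ] : (infoM f ξ).PosSemidef := by
  refine Matrix.PosSemidef.of_dotProduct_mulVec_nonneg ?_ fun v => ?_
  · ext i j
    simp [infoM, mul_comm]
  · have h : star v ⬝ᵥ infoM f ξ *ᵥ v = (infoM f ξ * Matrix.vecMulVec v v).trace := by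
      simp [Matrix.mul_vecMulVec, Matrix.trace_vecMulVec, dotProduct_comm]
    rw [h, trace_infoM hf]
    refine integral_nonneg fun x => ?_
    simp only [Matrix.vecMulVec_mulVec, Pi.zero_apply]
    have : f x ⬝ᵥ (MulOpposite.op (v ⬝ᵥ f x) • v) = (v ⬝ᵥ f x) * (v ⬝ᵥ f x) := by
      simp [dotProduct_smul, dotProduct_comm]
    rw [this]
    exact mul_self_nonneg _

lemma augM_posDef [CompactSpace X] {f : X → Fin p → ℝ} (hf : Continuous f)
    {M0 : Matrix (Fin p) (Fin p) ℝ} (hM0 : M0.PosDef) {a : ℝ} (ha : a ∈ Set.Ioo (0 : ℝ) 1)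
    (ξ : Measure X) [IsFiniteMeasure ξ] : (augM f M0 a ξ).PosDef := by
  unfold augM
  exact Matrix.PosDef.posSemidef_add ((infoM_posSemidef hf ξ).smul ha.1.le)
    (hM0.smul (sub_pos.2 ha.2))

lemma sens_cont {f : X → Fin p → ℝ} (hf : Continuous f)
    (M0 : Matrix (Fin p) (Fin p) ℝ) (a : ℝ) (ξ : Measure X) :
    Continuous (sens f M0 a ξ) := by
  unfold sens
  have hc : ∀ i, Continuous fun x => f x i := fun i => (continuous_apply i).comp hf
  simp only [quad_expand]
  fun_prop

lemma integral_sens [CompactSpace X] {f : X → Fin p → ℝ} (hf : Continuous f)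
    (M0 : Matrix (Fin p) (Fin p) ℝ) (a : ℝ) (ξ η : Measure X)
    [IsProbabilityMeasure η] :
    ∫ x, sens f M0 a ξ x ∂η = (infoM f ξ * (augM f M0 a ξ)⁻¹).trace
      - (infoM f η * (augM f M0 a ξ)⁻¹).trace := by
  have hc : ∀ i, Continuous fun x => f x i := fun i => (continuous_apply i).comp hf
  unfold sens
  rw [trace_infoM hf η, integral_sub (integrable_const _)]
  · simp
  · simp only [quad_expand]
    exact integrable_cont (by fun_prop) η

lemma bddBelow_sens [CompactSpace X] {f : X → Fin p → ℝ} (hf : Continuous f)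
    (M0 : Matrix (Fin p) (Fin p) ℝ) (a : ℝ) (ξ : Measure X) :
    BddBelow (Set.range (sens f M0 a ξ)) :=
  (isCompact_range (sens_cont hf M0 a ξ)).bddBelow

/-- the infimum of the sensitivity function is never positive -/
lemma iInf_sens_nonpos [CompactSpace X] {f : X → Fin p → ℝ} (hf : Continuous f)
    (M0 : Matrix (Fin p) (Fin p) ℝ) (a : ℝ) (ξ : Measure X) [IsProbabilityMeasure ξ] :
    (⨅ x, sens f M0 a ξ x) ≤ 0 := by
  have h := integral_sens hf M0 a ξ ξ
  rw [sub_self] at h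
  rw [← h]
  have h2 : ∫ _x, (⨅ x, sens f M0 a ξ x) ∂ξ ≤ ∫ x, sens f M0 a ξ x ∂ξ :=
    integral_mono (integrable_const _) (integrable_cont (sens_cont hf M0 a ξ) ξ)
      fun x => ciInf_le (bddBelow_sens hf M0 a ξ) x
  simpa using h2

lemma trace_aug [CompactSpace X] {f : X → Fin p → ℝ}
    (M0 A : Matrix (Fin p) (Fin p) ℝ) (a : ℝ) (ξ η : Measure X) :
    (augM f M0 a η * A).trace = (augM f M0 a ξ * A).trace
      - a * ((infoM f ξ * A).trace - (infoM f η * A).trace) := by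
  simp only [augM, Matrix.add_mul, Matrix.trace_add, Matrix.smul_mul, Matrix.trace_smul,
    smul_eq_mul]
  ring

/-- nonnegative sensitivity implies optimality -/
lemma opt_of_sens [CompactSpace X] {f : X → Fin p → ℝ} (hf : Continuous f)
    {M0 : Matrix (Fin p) (Fin p) ℝ} (hM0 : M0.PosDef) {a : ℝ} (ha : a ∈ Set.Ioo (0 : ℝ) 1)
    (ξ η : Measure X) [IsProbabilityMeasure ξ] [IsProbabilityMeasure η]
    (h : ∀ x, 0 ≤ sens f M0 a ξ x) : (augM f M0 a η).det ≤ (augM f M0 a ξ).det := by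
  have hR := augM_posDef hf hM0 ha ξ
  refine det_le_of_trace hR (augM_posDef hf hM0 ha η).posSemidef ?_
  have h1 := integral_sens hf M0 a ξ η
  have h2 : 0 ≤ ∫ x, sens f M0 a ξ x ∂η := integral_nonneg h
  rw [trace_aug M0 _ a ξ η, Matrix.mul_nonsing_inv _ hR.det_pos.ne'.isUnit, ← h1]
  have := mul_nonneg ha.1.le h2
  simp only [Matrix.trace_one, Fintype.card_fin]
  linarith

lemma deriv_aux {p : ℕ} (A : Matrix (Fin p) (Fin p) ℝ)
    (h : ∀ t ∈ Set.Ioo (0 : ℝ) 1, (1 + t • A).det ≤ 1) : A.trace ≤ 0 := by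
  by_contra! hc
  set q := (1 + (Polynomial.X : Polynomial ℝ) • A.map Polynomial.C).det.divX.divX with hq
  have hcont : Filter.Tendsto (fun t : ℝ => A.trace + q.eval t * t) (nhdsWithin 0 (Set.Ioi 0))
      (nhds (A.trace + q.eval 0 * 0)) := by
    apply Filter.Tendsto.mono_left _ nhdsWithin_le_nhds
    exact Continuous.tendsto (by fun_prop) 0
  have hpos : ∀ᶠ t in nhdsWithin (0 : ℝ) (Set.Ioi 0), 0 < A.trace + q.eval t * t :=
    hcont.eventually_const_lt (by simpa using hc)
  have hI : ∀ᶠ t in nhdsWithin (0 : ℝ) (Set.Ioi 0), t ∈ Set.Ioo (0 : ℝ) 1 :=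
    Ioo_mem_nhdsGT one_pos
  obtain ⟨t, h1, h2⟩ := (hpos.and hI).exists
  have h3 := h t h2
  rw [Matrix.det_one_add_smul] at h3
  have := mul_pos h1 h2.1
  rw [← hq] at h3
  nlinarith

noncomputable def mixD (ξ : Measure X) (x : X) (t : ℝ) : Measure X :=
  ENNReal.ofReal (1 - t) • ξ + ENNReal.ofReal t • Measure.dirac x

lemma mixD_prob (ξ : Measure X) [IsProbabilityMeasure ξ] (x : X) {t : ℝ}
    (ht : t ∈ Set.Ioo (0 : ℝ) 1) : IsProbabilityMeasure (mixD ξ x t) := by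
  constructor
  simp only [mixD, Measure.add_apply, Measure.smul_apply, measure_univ, smul_eq_mul, mul_one]
  rw [← ENNReal.ofReal_add (by linarith [ht.2]) ht.1.le]
  simp

lemma infoM_mixD [CompactSpace X] {f : X → Fin p → ℝ} (hf : Continuous f)
    (ξ : Measure X) [IsProbabilityMeasure ξ] (x : X) {t : ℝ}
    (ht : t ∈ Set.Ioo (0 : ℝ) 1) :
    infoM f (mixD ξ x t) = (1 - t) • infoM f ξ + t • infoM f (Measure.dirac x) := by
  have hc : ∀ i, Continuous fun x => f x i := fun i => (continuous_apply i).comp hf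
  ext i j
  have hi : Continuous fun x => f x i * f x j := by fun_prop
  simp only [infoM, Matrix.add_apply, Matrix.smul_apply, Matrix.of_apply, mixD]
  rw [integral_add_measure, integral_smul_measure, integral_smul_measure,
    ENNReal.toReal_ofReal (by linarith [ht.2]), ENNReal.toReal_ofReal ht.1.le]
  · exact (integrable_cont hi ξ).smul_measure ENNReal.ofReal_ne_top
  · exact (integrable_cont hi (Measure.dirac x)).smul_measure ENNReal.ofReal_ne_top

lemma augM_mixD [CompactSpace X] {f : X → Fin p → ℝ} (hf : Continuous f)
    (M0 : Matrix (Fin p) (Fin p) ℝ) (a : ℝ)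
    (ξ : Measure X) [IsProbabilityMeasure ξ] (x : X) {t : ℝ}
    (ht : t ∈ Set.Ioo (0 : ℝ) 1) :
    augM f M0 a (mixD ξ x t) = augM f M0 a ξ
      + t • (a • (infoM f (Measure.dirac x) - infoM f ξ)) := by
  rw [augM, infoM_mixD hf ξ x ht, augM]
  module

/-- optimality implies nonnegative sensitivity -/
lemma sens_of_opt [CompactSpace X] {f : X → Fin p → ℝ} (hf : Continuous f)
    {M0 : Matrix (Fin p) (Fin p) ℝ} (hM0 : M0.PosDef) {a : ℝ} (ha : a ∈ Set.Ioo (0 : ℝ) 1)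
    (ξ : Measure X) [IsProbabilityMeasure ξ]
    (h : ∀ η : Measure X, IsProbabilityMeasure η →
      (augM f M0 a η).det ≤ (augM f M0 a ξ).det) (x : X) : 0 ≤ sens f M0 a ξ x := by
  have hR := augM_posDef hf hM0 ha ξ
  set R := augM f M0 a ξ with hRdef
  set N := infoM f (Measure.dirac x) - infoM f ξ with hN
  have hu : IsUnit R.det := hR.det_pos.ne'.isUnit
  have key : ((a • N) * R⁻¹).trace ≤ 0 := by
    apply deriv_aux
    intro t ht
    have h1 := h _ (mixD_prob ξ x ht)
    rw [augM_mixD hf M0 a ξ x ht, ← hRdef, ← hN] at h1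
    have h2 : (1 + t • (a • N * R⁻¹)) * R = R + t • (a • N) := by
      rw [Matrix.add_mul, Matrix.one_mul, Matrix.smul_mul, Matrix.mul_assoc,
        Matrix.nonsing_inv_mul _ hu, Matrix.mul_one]
    rw [← h2, Matrix.det_mul] at h1
    exact le_of_mul_le_mul_right (by linarith) hR.det_pos
  have h3 : sens f M0 a ξ x = -(N * R⁻¹).trace := by
    have h4 := integral_sens hf M0 a ξ (Measure.dirac x)
    rw [integral_dirac] at h4
    rw [h4, hN, Matrix.sub_mul, Matrix.trace_sub]
    ring
  rw [Matrix.smul_mul, Matrix.trace_smul, smul_eq_mul] at key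
  have := nonpos_of_mul_nonpos_right key ha.1
  linarith

/-- existence of an optimal design -/
lemma exists_opt [CompactSpace X] {f : X → Fin p → ℝ} (hf : Continuous f)
    (M0 : Matrix (Fin p) (Fin p) ℝ) (a : ℝ)
    (ξs : Measure X) [IsProbabilityMeasure ξs] :
    ∃ ξ : Measure X, IsProbabilityMeasure ξ ∧ ∀ η : Measure X, IsProbabilityMeasure η →
      (augM f M0 a η).det ≤ (augM f M0 a ξ).det := by
  have hc : ∀ i, Continuous fun x => f x i := fun i => (continuous_apply i).comp hf
  have hcont : Continuous fun μ : ProbabilityMeasure X =>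
      (augM f M0 a (μ : Measure X)).det := by
    apply Continuous.matrix_det
    refine continuous_matrix fun i j => ?_
    simp only [augM, infoM, Matrix.add_apply, Matrix.smul_apply, Matrix.of_apply]
    have := ProbabilityMeasure.continuous_integral_boundedContinuousFunction
      (BoundedContinuousFunction.mkOfCompact
        (⟨fun x => f x i * f x j, by fun_prop⟩ : C(X, ℝ)))
    exact (this.const_smul a).add continuous_const
  haveI : Nonempty (ProbabilityMeasure X) := ⟨⟨ξs, inferInstance⟩⟩
  obtain ⟨μ, -, hμ⟩ := isCompact_univ.exists_isMaxOn Set.univ_nonempty hcont.continuousOn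
  exact ⟨μ, inferInstance, fun η hη => hμ (Set.mem_univ (⟨η, hη⟩ : ProbabilityMeasure X))⟩

end

/-- Maximin characterization of the general equivalence theorem (D-criterion case):
`ξ*` maximizes `det R(ξ)` iff it maximizes `ξ ↦ inf_{x ∈ X} ν_ξ(x)`; moreover the
maximal value of `ξ ↦ inf_{x ∈ X} ν_ξ(x)` is `0`. -/
theorem stmt7 {s p : ℕ} (X : Set (Fin s → ℝ)) (hX : IsCompact X)
    (f : X → Fin p → ℝ) (hf : Continuous f)
    (M0 : Matrix (Fin p) (Fin p) ℝ) (hM0 : M0.PosDef)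
    (a : ℝ) (ha : a ∈ Set.Ioo (0 : ℝ) 1)
    (ξs : Measure X) [IsProbabilityMeasure ξs] :
    ((∀ ξ : Measure X, IsProbabilityMeasure ξ →
          (augM f M0 a ξ).det ≤ (augM f M0 a ξs).det) ↔
        (∀ ξ : Measure X, IsProbabilityMeasure ξ →
          (⨅ x : X, sens f M0 a ξ x) ≤ ⨅ x : X, sens f M0 a ξs x)) ∧
      ((∀ ξ : Measure X, IsProbabilityMeasure ξ →
          (augM f M0 a ξ).det ≤ (augM f M0 a ξs).det) →
        (⨅ x : X, sens f M0 a ξs x) = 0) := by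
  haveI : CompactSpace X := isCompact_iff_compactSpace.mp hX
  haveI : Nonempty X := nonempty_of_isProbabilityMeasure ξs
  have zero : ∀ ξ : Measure X, IsProbabilityMeasure ξ →
      (∀ η : Measure X, IsProbabilityMeasure η →
        (augM f M0 a η).det ≤ (augM f M0 a ξ).det) → (⨅ x : X, sens f M0 a ξ x) = 0 :=
    fun ξ _ h => le_antisymm (iInf_sens_nonpos hf M0 a ξ)
      (le_ciInf (sens_of_opt hf hM0 ha ξ h))
  refine ⟨⟨fun h ξ _ => ?_, fun h ξ _ => ?_⟩, zero ξs inferInstance⟩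
  · rw [zero ξs inferInstance h]
    exact iInf_sens_nonpos hf M0 a ξ
  · obtain ⟨μ, hμ, hopt⟩ := exists_opt hf M0 a ξs
    have h1 := h μ hμ
    rw [zero μ hμ hopt] at h1
    exact opt_of_sens hf hM0 ha ξs ξ
      fun x => h1.trans (ciInf_le (bddBelow_sens hf M0 a ξs) x)
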